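/- arXiv:0802.0940 — 4 statements merged into one kernel-verified Lean document; each statement's English description precedes it below -/
import Mathlib

section
/- For all Schwartz functions f, g : ℝ^D → ℂ, the function x ↦ (f⋆g)(x) is integrable on ℝ^D and ∫_{ℝ^D} (f⋆g)(x) dx = ∫_{ℝ^D} f(x) g(x) dx; that is, under the integral sign the Moyal product can be replaced by the ordinary pointwise product. -/
open MeasureTheory Matrix

/-- The Moyal product of two Schwartz functions on `ℝ^D`:
`(f⋆g)(x) = (2π)^{−D} ∫∫ f(x + ½Θk) g(x+y) e^{i⟨k,y⟩} dy dk`. -/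
noncomputable def moyal {D : ℕ} (Θ : Matrix (Fin D) (Fin D) ℝ)
    (f g : SchwartzMap (Fin D → ℝ) ℂ) : (Fin D → ℝ) → ℂ := fun x =>
  (((2 * Real.pi) ^ D)⁻¹ : ℝ) •
    ∫ k : Fin D → ℝ, ∫ y : Fin D → ℝ,
      f (x + (2⁻¹ : ℝ) • Θ.mulVec k) * g (x + y) *
        Complex.exp (Complex.I * ((∑ i, k i * y i : ℝ) : ℂ))

open scoped FourierTransform

/-- Fourier inversion on `ℝ^D` in the angular-frequency convention, for coordinate vectors. -/
lemma SchwartzMap.exists_fourier_inversion_pi {D : ℕ} (g : SchwartzMap (Fin D → ℝ) ℂ) :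
    ∃ G : SchwartzMap (Fin D → ℝ) ℂ,
      (∀ k, ∫ y, g y * Complex.exp (Complex.I * ((k ⬝ᵥ y : ℝ) : ℂ)) = G k) ∧
      ∀ x, (((2 * Real.pi) ^ D)⁻¹ : ℝ) •
        ∫ k, G k * Complex.exp (-(Complex.I * ((k ⬝ᵥ x : ℝ) : ℂ))) = g x := by
  have hpi : (2 * Real.pi) ≠ 0 := by positivity
  let e := EuclideanSpace.equiv (Fin D) ℝ
  let h : SchwartzMap (EuclideanSpace ℝ (Fin D)) ℂ :=
    𝓕⁻ (SchwartzMap.compCLMOfContinuousLinearEquiv ℂ e g)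
  let s : (Fin D → ℝ) ≃L[ℝ] (Fin D → ℝ) :=
    ContinuousLinearEquiv.smulLeft (Units.mk0 (2 * Real.pi)⁻¹ (inv_ne_zero hpi))
  have htoLp (φ : EuclideanSpace ℝ (Fin D) → ℂ) :
      ∫ v, φ v = ∫ v : Fin D → ℝ, φ (WithLp.toLp 2 v) :=
    ((PiLp.volume_preserving_toLp (Fin D)).integral_comp
      (MeasurableEquiv.toLp 2 (Fin D → ℝ)).measurableEmbedding φ).symm
  refine ⟨SchwartzMap.compCLMOfContinuousLinearEquiv ℂ (s.trans e.symm) h, fun k => ?_,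
    fun x => ?_⟩
  · have hk : SchwartzMap.compCLMOfContinuousLinearEquiv ℂ (s.trans e.symm) h k =
        h (WithLp.toLp 2 ((2 * Real.pi)⁻¹ • k)) := rfl
    rw [hk, SchwartzMap.fourierInv_coe, Real.fourierInv_eq', htoLp]
    refine integral_congr_ae (.of_forall fun y => ?_)
    have hy : SchwartzMap.compCLMOfContinuousLinearEquiv ℂ e g (WithLp.toLp 2 y) = g y := rfl
    simp only [hy, EuclideanSpace.inner_toLp_toLp, star_trivial, smul_dotProduct, smul_eq_mul]
    rw [mul_inv_cancel_left₀ hpi, mul_comm, mul_comm Complex.I]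
  · have hinv : 𝓕 h (WithLp.toLp 2 x) = g x := by
      simp only [h, FourierTransform.fourier_fourierInv_eq]
      rfl
    rw [SchwartzMap.fourier_coe, Real.fourier_eq', htoLp] at hinv
    rw [← hinv]
    have hscale := Measure.integral_comp_inv_smul volume (fun v : Fin D → ℝ =>
      h (WithLp.toLp 2 v) * Complex.exp (-(Complex.I * ((2 * Real.pi * (v ⬝ᵥ x) : ℝ) : ℂ))))
      (2 * Real.pi)
    rw [Module.finrank_fin_fun, abs_of_pos (by positivity)] at hscale
    have hG : ∀ k, SchwartzMap.compCLMOfContinuousLinearEquiv ℂ (s.trans e.symm) h k *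
        Complex.exp (-(Complex.I * ((k ⬝ᵥ x : ℝ) : ℂ))) =
        h (WithLp.toLp 2 ((2 * Real.pi)⁻¹ • k)) * Complex.exp (-(Complex.I *
          ((2 * Real.pi * (((2 * Real.pi)⁻¹ • k) ⬝ᵥ x) : ℝ) : ℂ))) := fun k => by
      rw [smul_dotProduct, smul_eq_mul, mul_inv_cancel_left₀ hpi]
      rfl
    simp_rw [hG]
    rw [hscale, inv_smul_smul₀ (by positivity)]
    refine integral_congr_ae (.of_forall fun v => ?_)
    simp only [EuclideanSpace.inner_toLp_toLp, star_trivial, smul_eq_mul, dotProduct_comm x v]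
    rw [mul_comm]
    congr 2
    push_cast
    ring

/-- Translating by `y ↦ x + y` factors the plane wave out of the Fourier integral. -/
lemma integral_translate_mul_exp {D : ℕ} (g : (Fin D → ℝ) → ℂ) (x k : Fin D → ℝ) :
    ∫ y, g (x + y) * Complex.exp (Complex.I * ((k ⬝ᵥ y : ℝ) : ℂ)) =
      (∫ y, g y * Complex.exp (Complex.I * ((k ⬝ᵥ y : ℝ) : ℂ))) *
        Complex.exp (-(Complex.I * ((k ⬝ᵥ x : ℝ) : ℂ))) := by
  rw [← integral_mul_const, ← integral_add_left_eq_self (μ := volume)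
    (fun y => g y * Complex.exp (Complex.I * ((k ⬝ᵥ y : ℝ) : ℂ)) *
      Complex.exp (-(Complex.I * ((k ⬝ᵥ x : ℝ) : ℂ)))) x]
  refine integral_congr_ae (.of_forall fun y => ?_)
  simp only [mul_assoc, ← Complex.exp_add, dotProduct_add]
  congr 2
  push_cast
  ring

/-- An antisymmetric matrix has vanishing quadratic form. -/
lemma dotProduct_mulVec_self_of_transpose_eq_neg {n : Type*} [Fintype n] {Θ : Matrix n n ℝ}
    (hΘ : Θᵀ = -Θ) (k : n → ℝ) : k ⬝ᵥ Θ *ᵥ k = 0 := by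
  have h : k ⬝ᵥ Θ *ᵥ k = -(k ⬝ᵥ Θ *ᵥ k) := by
    conv_lhs => rw [dotProduct_mulVec, ← mulVec_transpose, hΘ, neg_mulVec, neg_dotProduct,
      dotProduct_comm]
  linarith

/-- A sheared tensor product of Schwartz functions, modulated by a plane wave, is integrable. -/
lemma SchwartzMap.integrable_shear_mul_exp {D : ℕ} (f G : SchwartzMap (Fin D → ℝ) ℂ)
    {T : (Fin D → ℝ) → (Fin D → ℝ)} (hT : Continuous T) :
    Integrable (fun p : (Fin D → ℝ) × (Fin D → ℝ) => f (p.1 + T p.2) * (G p.2 *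
      Complex.exp (-(Complex.I * ((p.2 ⬝ᵥ p.1 : ℝ) : ℂ))))) (volume.prod volume) := by
  have hf := f.continuous
  have hG := G.continuous
  have hcont : Continuous fun p : (Fin D → ℝ) × (Fin D → ℝ) => f (p.1 + T p.2) * (G p.2 *
      Complex.exp (-(Complex.I * ((p.2 ⬝ᵥ p.1 : ℝ) : ℂ)))) := by
    unfold dotProduct
    fun_prop
  have hnorm (x k : Fin D → ℝ) :
      ‖f (x + T k) * (G k * Complex.exp (-(Complex.I * ((k ⬝ᵥ x : ℝ) : ℂ))))‖ =
        ‖f (x + T k)‖ * ‖G k‖ := by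
    rw [norm_mul, norm_mul, ← mul_neg, ← Complex.ofReal_neg, Complex.norm_exp_I_mul_ofReal, mul_one]
  refine (integrable_prod_iff' hcont.aestronglyMeasurable).2 ⟨.of_forall fun k => ?_, ?_⟩
  · refine ((f.integrable.comp_add_right (T k)).norm.mul_const ‖G k‖).mono'
      (hcont.comp (Continuous.prodMk_left k)).aestronglyMeasurable (.of_forall fun x => ?_)
    exact (hnorm x k).le
  · simp_rw [hnorm, integral_mul_const]
    simp_rw [fun k => integral_add_right_eq_self (μ := volume) (fun x => ‖f x‖) (T k)]
    exact G.integrable.norm.const_mul _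

/-- `x ↦ (f⋆g)(x)` is integrable and `∫ (f⋆g)(x) dx = ∫ f(x)g(x) dx`. -/
theorem stmt5 (D : ℕ) (hD : 0 < D) (hDe : Even D)
    (Θ : Matrix (Fin D) (Fin D) ℝ) (hΘ : IsUnit Θ) (hΘa : Θᵀ = -Θ)
    (f g : SchwartzMap (Fin D → ℝ) ℂ) :
    Integrable (moyal Θ f g) ∧
      ∫ x, moyal Θ f g x = ∫ x : Fin D → ℝ, f x * g x := by
  obtain ⟨G, hG, hinv⟩ := g.exists_fourier_inversion_pi
  have hmoyal : moyal Θ f g = fun x => (((2 * Real.pi) ^ D)⁻¹ : ℝ) • ∫ k : Fin D → ℝ,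
      f (x + (2⁻¹ : ℝ) • Θ *ᵥ k) *
        (G k * Complex.exp (-(Complex.I * ((k ⬝ᵥ x : ℝ) : ℂ)))) := by
    funext x
    unfold moyal
    congr 1
    refine integral_congr_ae (.of_forall fun k => ?_)
    simp only [mul_assoc]
    rw [integral_const_mul, ← hG k, ← integral_translate_mul_exp]
    rfl
  have hint := f.integrable_shear_mul_exp G (T := fun k => (2⁻¹ : ℝ) • Θ *ᵥ k)
    (by fun_prop)
  have hint₀ := f.integrable_shear_mul_exp G (T := fun _ => 0) continuous_const
  simp only [add_zero] at hint₀
  rw [hmoyal]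
  refine ⟨hint.integral_prod_left.smul (((2 * Real.pi) ^ D)⁻¹ : ℝ), ?_⟩
  rw [integral_smul, integral_integral_swap hint]
  have hshift (k : Fin D → ℝ) :
      ∫ x, f (x + (2⁻¹ : ℝ) • Θ *ᵥ k) *
        (G k * Complex.exp (-(Complex.I * ((k ⬝ᵥ x : ℝ) : ℂ)))) =
      ∫ x, f x * (G k * Complex.exp (-(Complex.I * ((k ⬝ᵥ x : ℝ) : ℂ)))) := by
    rw [← integral_add_right_eq_self (μ := volume)
      (fun x => f x * (G k * Complex.exp (-(Complex.I * ((k ⬝ᵥ x : ℝ) : ℂ)))))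
      ((2⁻¹ : ℝ) • Θ *ᵥ k)]
    simp only [dotProduct_add, dotProduct_smul,
      dotProduct_mulVec_self_of_transpose_eq_neg hΘa, smul_zero, add_zero]
  simp_rw [hshift]
  rw [← integral_integral_swap hint₀, ← integral_smul]
  refine integral_congr_ae (.of_forall fun x => ?_)
  simp only [integral_const_mul]
  rw [← mul_smul_comm, hinv]
end

section
/- For all Ω > 0 and B ∈ ℝ, the kernel K_{Ω,B} satisfies, for every t > 0 and all x, x' ∈ ℝ², the evolution equation ∂_t K + ½( −∂²_{x₀} K − ∂²_{x₁} K + Ω²(x₀² + x₁²) K ) − iB ( x₀ ∂_{x₁} K − x₁ ∂_{x₀} K ) = 0, all derivatives being taken in the variables (t, x₀, x₁) at fixed x'. Thus K_{Ω,B} is an integral kernel for the semigroup e^{−tH} of the magnetic harmonic-oscillator Hamiltonian H = ½[−∂₀² − ∂₁² + Ω²x² − 2iB(x₀∂₁ − x₁∂₀)]. -/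
/-- The exponent `A_{Ω,B}(t,x,x')` of the Mehler-type kernel. -/
noncomputable def Amehler (Ω B t x0 x1 y0 y1 : ℝ) : ℂ :=
  ((Ω * Real.cosh (Ω * t) / (2 * Real.sinh (Ω * t)) *
      (x0 ^ 2 + x1 ^ 2 + y0 ^ 2 + y1 ^ 2) : ℝ) : ℂ)
    - ((Ω * Real.cosh (B * t) / Real.sinh (Ω * t) * (x0 * y0 + x1 * y1) : ℝ) : ℂ)
    - Complex.I * ((Ω * Real.sinh (B * t) / Real.sinh (Ω * t) * (x0 * y1 - x1 * y0) : ℝ) : ℂ)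

/-- The Mehler-type kernel `K_{Ω,B}(t,x,x') = (Ω/(2π sinh(Ωt))) e^{−A_{Ω,B}}`. -/
noncomputable def Kmehler (Ω B t x0 x1 y0 y1 : ℝ) : ℂ :=
  ((Ω / (2 * Real.pi * Real.sinh (Ω * t)) : ℝ) : ℂ) *
    Complex.exp (-Amehler Ω B t x0 x1 y0 y1)

/-- The derivative of a Gaussian with complex coefficients along the real line. -/
lemma hasDerivAt_gaussian (g a b c : ℂ) (u : ℝ) :
    HasDerivAt (fun w : ℝ => g * Complex.exp (-(a * (w : ℂ) ^ 2 + b * w + c)))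
      (-(2 * a * u + b) * (g * Complex.exp (-(a * (u : ℂ) ^ 2 + b * u + c)))) u := by
  have hid : HasDerivAt (fun w : ℝ => (w : ℂ)) 1 u := Complex.ofRealCLM.hasDerivAt
  have h := (((((hid.pow 2).const_mul a).add (hid.const_mul b)).add_const c).neg.cexp).const_mul g
  refine h.congr_deriv ?_
  simp
  ring

/-- The second derivative of a Gaussian with complex coefficients along the real line. -/
lemma hasDerivAt_deriv_gaussian (g a b c : ℂ) (u : ℝ) :
    HasDerivAt (deriv fun w : ℝ => g * Complex.exp (-(a * (w : ℂ) ^ 2 + b * w + c)))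
      (((2 * a * u + b) ^ 2 - 2 * a) * (g * Complex.exp (-(a * (u : ℂ) ^ 2 + b * u + c)))) u := by
  have hd : (deriv fun w : ℝ => g * Complex.exp (-(a * (w : ℂ) ^ 2 + b * w + c))) =
      fun w : ℝ => -(2 * a * w + b) * (g * Complex.exp (-(a * (w : ℂ) ^ 2 + b * w + c))) :=
    funext fun w => (hasDerivAt_gaussian g a b c w).deriv
  rw [hd]
  have hid : HasDerivAt (fun w : ℝ => (w : ℂ)) 1 u := Complex.ofRealCLM.hasDerivAt
  have h := (((hid.const_mul (2 * a)).add_const b).neg).mul (hasDerivAt_gaussian g a b c u)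
  refine h.congr_deriv ?_
  simp
  ring

/-- The kernel is a Gaussian in the first coordinate. -/
lemma Kmehler_eq_gaussian_fst (Ω B t x1 y0 y1 w : ℝ) :
    Kmehler Ω B t w x1 y0 y1 = ((Ω / (2 * Real.pi * Real.sinh (Ω * t)) : ℝ) : ℂ) *
      Complex.exp (-(((Ω * Real.cosh (Ω * t) / (2 * Real.sinh (Ω * t)) : ℝ) : ℂ) * (w : ℂ) ^ 2
        + (-((Ω * Real.cosh (B * t) / Real.sinh (Ω * t) * y0 : ℝ) : ℂ)
            - Complex.I * ((Ω * Real.sinh (B * t) / Real.sinh (Ω * t) * y1 : ℝ) : ℂ)) * w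
        + Amehler Ω B t 0 x1 y0 y1)) := by
  unfold Kmehler Amehler
  congr 3
  push_cast
  ring

/-- The kernel is a Gaussian in the second coordinate. -/
lemma Kmehler_eq_gaussian_snd (Ω B t x0 y0 y1 w : ℝ) :
    Kmehler Ω B t x0 w y0 y1 = ((Ω / (2 * Real.pi * Real.sinh (Ω * t)) : ℝ) : ℂ) *
      Complex.exp (-(((Ω * Real.cosh (Ω * t) / (2 * Real.sinh (Ω * t)) : ℝ) : ℂ) * (w : ℂ) ^ 2
        + (-((Ω * Real.cosh (B * t) / Real.sinh (Ω * t) * y1 : ℝ) : ℂ)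
            + Complex.I * ((Ω * Real.sinh (B * t) / Real.sinh (Ω * t) * y0 : ℝ) : ℂ)) * w
        + Amehler Ω B t x0 0 y0 y1)) := by
  unfold Kmehler Amehler
  congr 3
  push_cast
  ring

/-- The time derivative of the kernel. -/
lemma hasDerivAt_Kmehler_time (Ω B t x0 x1 y0 y1 : ℝ) (hS : Real.sinh (Ω * t) ≠ 0) :
    HasDerivAt (fun s => Kmehler Ω B s x0 x1 y0 y1)
      ((-((Ω * Real.cosh (Ω * t) / Real.sinh (Ω * t) : ℝ) : ℂ)
        + ((Ω ^ 2 / (2 * Real.sinh (Ω * t) ^ 2) * (x0 ^ 2 + x1 ^ 2 + y0 ^ 2 + y1 ^ 2) : ℝ) : ℂ)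
        + ((Ω * (B * Real.sinh (B * t) * Real.sinh (Ω * t)
              - Ω * Real.cosh (B * t) * Real.cosh (Ω * t)) / Real.sinh (Ω * t) ^ 2
            * (x0 * y0 + x1 * y1) : ℝ) : ℂ)
        + Complex.I * ((Ω * (B * Real.cosh (B * t) * Real.sinh (Ω * t)
              - Ω * Real.sinh (B * t) * Real.cosh (Ω * t)) / Real.sinh (Ω * t) ^ 2
            * (x0 * y1 - x1 * y0) : ℝ) : ℂ)) * Kmehler Ω B t x0 x1 y0 y1) t := by
  have hlin (c : ℝ) : HasDerivAt (fun s : ℝ => c * s) c t := by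
    simpa using (hasDerivAt_id t).const_mul c
  have hsinh := (hlin Ω).sinh
  have hcosh := (hlin Ω).cosh
  have hpref := ((hasDerivAt_const t Ω).div (hsinh.const_mul (2 * Real.pi))
    (mul_ne_zero (by positivity) hS)).ofReal_comp
  have hdiag := (((hcosh.const_mul Ω).div (hsinh.const_mul 2)
    (mul_ne_zero two_ne_zero hS)).mul_const (x0 ^ 2 + x1 ^ 2 + y0 ^ 2 + y1 ^ 2)).ofReal_comp
  have hdot := ((((hlin B).cosh.const_mul Ω).div hsinh hS).mul_const
    (x0 * y0 + x1 * y1)).ofReal_comp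
  have hwedge := ((((hlin B).sinh.const_mul Ω).div hsinh hS).mul_const
    (x0 * y1 - x1 * y0)).ofReal_comp
  have h := hpref.mul ((hdiag.sub hdot).sub (hwedge.const_mul Complex.I)).neg.cexp
  refine h.congr_deriv ?_
  have hcs : (Real.cosh (Ω * t) : ℂ) ^ 2 = (Real.sinh (Ω * t) : ℂ) ^ 2 + 1 := by
    exact_mod_cast Real.cosh_sq (Ω * t)
  have hS' : (Real.sinh (Ω * t) : ℂ) ≠ 0 := by exact_mod_cast hS
  have hpi : (Real.pi : ℂ) ≠ 0 := by exact_mod_cast Real.pi_ne_zero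
  change _ = _ * (_ * Complex.exp (-Amehler Ω B t x0 x1 y0 y1))
  change _ * Complex.exp (-Amehler Ω B t x0 x1 y0 y1)
    + _ * (Complex.exp (-Amehler Ω B t x0 x1 y0 y1) * _) = _
  generalize Complex.exp (-Amehler Ω B t x0 x1 y0 y1) = E
  simp only [Complex.ofReal_mul, Complex.ofReal_div, Complex.ofReal_add, Complex.ofReal_sub,
    Complex.ofReal_pow, Complex.ofReal_ofNat, Complex.ofReal_zero, Pi.div_apply]
  generalize (Real.sinh (Ω * t) : ℂ) = S at *
  generalize (Real.cosh (Ω * t) : ℂ) = C at *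
  field_simp
  simp only [hcs]
  ring

/-- `K_{Ω,B}` satisfies the evolution equation
`∂_t K + ½(−∂²_{x₀} K − ∂²_{x₁} K + Ω²(x₀²+x₁²) K) − iB(x₀∂_{x₁}K − x₁∂_{x₀}K) = 0`. -/
theorem stmt8 (Ω B : ℝ) (hΩ : 0 < Ω) (t : ℝ) (ht : 0 < t) (x0 x1 y0 y1 : ℝ) :
    deriv (fun s => Kmehler Ω B s x0 x1 y0 y1) t
      + (1 / 2 : ℂ) *
          (-(deriv (fun u => deriv (fun w => Kmehler Ω B t w x1 y0 y1) u) x0)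
            - deriv (fun u => deriv (fun w => Kmehler Ω B t x0 w y0 y1) u) x1
            + ((Ω ^ 2 * (x0 ^ 2 + x1 ^ 2) : ℝ) : ℂ) * Kmehler Ω B t x0 x1 y0 y1)
      - Complex.I * (B : ℂ) *
          ((x0 : ℂ) * deriv (fun w => Kmehler Ω B t x0 w y0 y1) x1
            - (x1 : ℂ) * deriv (fun w => Kmehler Ω B t w x1 y0 y1) x0) = 0 := by
  have hS : Real.sinh (Ω * t) ≠ 0 := (Real.sinh_pos_iff.mpr (mul_pos hΩ ht)).ne'
  rw [(hasDerivAt_Kmehler_time Ω B t x0 x1 y0 y1 hS).deriv]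
  simp only [Kmehler_eq_gaussian_fst Ω B t x1, Kmehler_eq_gaussian_snd Ω B t x0]
  rw [(hasDerivAt_deriv_gaussian _ _ _ _ x0).deriv, (hasDerivAt_deriv_gaussian _ _ _ _ x1).deriv,
    (hasDerivAt_gaussian _ _ _ _ x0).deriv, (hasDerivAt_gaussian _ _ _ _ x1).deriv]
  simp only [← Kmehler_eq_gaussian_fst, ← Kmehler_eq_gaussian_snd]
  generalize Kmehler Ω B t x0 x1 y0 y1 = K
  have hcs : (Real.cosh (Ω * t) : ℂ) ^ 2 = (Real.sinh (Ω * t) : ℂ) ^ 2 + 1 := by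
    exact_mod_cast Real.cosh_sq (Ω * t)
  have hcsB : (Real.cosh (B * t) : ℂ) ^ 2 = (Real.sinh (B * t) : ℂ) ^ 2 + 1 := by
    exact_mod_cast Real.cosh_sq (B * t)
  have hS' : (Real.sinh (Ω * t) : ℂ) ≠ 0 := by exact_mod_cast hS
  have hI := Complex.I_sq
  simp only [Complex.ofReal_mul, Complex.ofReal_div, Complex.ofReal_add, Complex.ofReal_sub,
    Complex.ofReal_pow, Complex.ofReal_ofNat]
  generalize (Real.sinh (Ω * t) : ℂ) = S at *
  generalize (Real.cosh (Ω * t) : ℂ) = C at *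
  generalize (Real.sinh (B * t) : ℂ) = s at *
  generalize (Real.cosh (B * t) : ℂ) = c at *
  generalize Complex.I = I at *
  field_simp
  grind
end

section
/- Let f : ℝ → ℂ be a Schwartz function and let s ∈ (−1, 0). Then ∫_{0}^{∞} f(u) e^{−iu} du = (1/2π) ∫_{−∞}^{∞} Γ(−s−it) ( ∫_{0}^{∞} f(u) e^{(s+it)(ln u + iπ/2)} du ) dt, where Γ is the complex Gamma function, e^{(s+it)(ln u + iπ/2)} = (iu)^{s+it} is the principal power, and the outer integral over t converges absolutely. -/
open MeasureTheory

theorem integrableOn_rpow_mul_exp_neg_mul {q b : ℝ} (hq : -1 < q) (hb : 0 < b) :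
    IntegrableOn (fun u : ℝ => u ^ q * Real.exp (-(b * u))) (Set.Ioi 0) := by
  simpa using integrableOn_rpow_mul_exp_neg_mul_rpow hq one_pos hb

theorem norm_cpow_mul_exp_neg_mul {a r : ℂ} {u : ℝ} (hu : 0 < u) :
    ‖(u : ℂ) ^ a * Complex.exp (-(r * u))‖ = u ^ a.re * Real.exp (-(r.re * u)) := by
  rw [norm_mul, Complex.norm_cpow_eq_rpow_re_of_pos hu, Complex.norm_exp]
  simp

theorem continuousOn_cpow_mul_exp_neg_mul (a r : ℂ) :
    ContinuousOn (fun u : ℝ => (u : ℂ) ^ a * Complex.exp (-(r * u))) (Set.Ioi 0) := by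
  refine ContinuousOn.mul (fun u hu => ?_) (by fun_prop)
  exact (Complex.continuousAt_ofReal_cpow_const u a (Or.inr (ne_of_gt hu))).continuousWithinAt

theorem integrableOn_cpow_mul_exp_neg_mul {a r : ℂ} (ha : -1 < a.re) (hr : 0 < r.re) :
    IntegrableOn (fun u : ℝ => (u : ℂ) ^ a * Complex.exp (-(r * u))) (Set.Ioi 0) := by
  refine (integrableOn_rpow_mul_exp_neg_mul ha hr).mono'
    ((continuousOn_cpow_mul_exp_neg_mul a r).aestronglyMeasurable measurableSet_Ioi) ?_
  filter_upwards [ae_restrict_mem measurableSet_Ioi] with u hu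
  exact (norm_cpow_mul_exp_neg_mul hu).le

theorem differentiableAt_integral_cpow_mul_exp_neg_mul {a r : ℂ} (ha : -1 < a.re)
    (hr : 0 < r.re) :
    DifferentiableAt ℂ
      (fun r : ℂ => ∫ u in Set.Ioi (0 : ℝ), (u : ℂ) ^ a * Complex.exp (-(r * u))) r := by
  have hs : {z : ℂ | r.re / 2 < z.re} ∈ nhds r :=
    (isOpen_lt continuous_const Complex.continuous_re).mem_nhds (by simp; linarith)
  refine (hasDerivAt_integral_of_dominated_loc_of_deriv_le
    (F' := fun r (u : ℝ) => (u : ℂ) ^ a * (Complex.exp (-(r * u)) * (-u)))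
    (bound := fun u => u ^ (a.re + 1) * Real.exp (-(r.re / 2 * u))) hs
    (.of_forall fun z =>
      (continuousOn_cpow_mul_exp_neg_mul a z).aestronglyMeasurable measurableSet_Ioi)
    (integrableOn_cpow_mul_exp_neg_mul ha hr) ?_ ?_
    (integrableOn_rpow_mul_exp_neg_mul (by linarith) (by linarith)) ?_).2.differentiableAt
  · refine ContinuousOn.aestronglyMeasurable ?_ measurableSet_Ioi
    simp only [← mul_assoc]
    exact (continuousOn_cpow_mul_exp_neg_mul a r).mul (by fun_prop)
  · filter_upwards [ae_restrict_mem measurableSet_Ioi] with u hu z hz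
    have hu : 0 < u := hu
    rw [← mul_assoc, norm_mul, norm_cpow_mul_exp_neg_mul hu, norm_neg, Complex.norm_real,
      Real.norm_of_nonneg hu.le, Real.rpow_add_one hu.ne', mul_right_comm]
    have : r.re / 2 < z.re := hz
    gcongr
  · refine .of_forall fun u z _ => ?_
    simpa using (((hasDerivAt_id z).mul_const (u : ℂ)).neg.cexp).const_mul ((u : ℂ) ^ a)

/-- The Gamma integral along a ray of the open right half plane. -/
theorem integral_cpow_mul_exp_neg_mul_Ioi_of_re_pos {a r : ℂ} (ha : 0 < a.re) (hr : 0 < r.re) :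
    ∫ u in Set.Ioi (0 : ℝ), (u : ℂ) ^ (a - 1) * Complex.exp (-(r * u)) =
      r ^ (-a) * Complex.Gamma a := by
  have hU : IsOpen {z : ℂ | 0 < z.re} := isOpen_lt continuous_const Complex.continuous_re
  have hL : DifferentiableOn ℂ (fun r : ℂ => ∫ u in Set.Ioi (0 : ℝ),
      (u : ℂ) ^ (a - 1) * Complex.exp (-(r * u))) {z : ℂ | 0 < z.re} := fun z hz =>
    (differentiableAt_integral_cpow_mul_exp_neg_mul (by simpa using ha) hz).differentiableWithinAt
  have hR : DifferentiableOn ℂ (fun r : ℂ => r ^ (-a) * Complex.Gamma a) {z : ℂ | 0 < z.re} :=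
    fun z hz => ((differentiableAt_id.cpow_const (Or.inl hz)).mul_const _).differentiableWithinAt
  refine (hL.analyticOnNhd hU).eqOn_of_preconnected_of_frequently_eq (hR.analyticOnNhd hU)
    (convex_halfSpace_re_gt 0).isPreconnected (z₀ := 1) (by simp) ?_ hr
  have ht : Filter.Tendsto (fun x : ℝ => (x : ℂ)) (nhdsWithin 1 {1}ᶜ) (nhdsWithin 1 {1}ᶜ) := by
    refine tendsto_nhdsWithin_iff.2 ⟨?_, ?_⟩
    · exact (Complex.continuous_ofReal.tendsto' 1 1 (by simp)).mono_left nhdsWithin_le_nhds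
    · filter_upwards [self_mem_nhdsWithin] with x hx
      simpa using hx
  refine ht.frequently (Filter.Eventually.frequently ?_)
  filter_upwards [nhdsWithin_le_nhds (lt_mem_nhds zero_lt_one)] with x hx
  rw [Complex.integral_cpow_mul_exp_neg_mul_Ioi ha hx, one_div, Complex.cpow_neg,
    Complex.inv_cpow _ _ (by simp [Complex.arg_ofReal_of_nonneg hx.le, Real.pi_ne_zero.symm])]

theorem exp_mul_I_cpow {φ : ℝ} (h1 : -(Real.pi / 2) < φ) (h2 : φ < Real.pi / 2) (z : ℂ) :
    Complex.exp (φ * Complex.I) ^ z = Complex.exp (φ * Complex.I * z) := by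
  rw [Complex.cpow_def_of_ne_zero (Complex.exp_ne_zero _), Complex.log_exp]
  · simp; linarith [Real.pi_pos]
  · simp; linarith [Real.pi_pos]

theorem mellin_exp_neg_mul {z r : ℂ} (hz : 0 < z.re) (hr : 0 < r.re) :
    mellin (fun u : ℝ => Complex.exp (-(r * u))) z = r ^ (-z) * Complex.Gamma z :=
  integral_cpow_mul_exp_neg_mul_Ioi_of_re_pos hz hr

/-- Rotating the contour of the Gamma integral by an angle `φ`. -/
theorem norm_Gamma_mul_exp_mul_im_le {z : ℂ} {φ : ℝ} (hz : 0 < z.re)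
    (h1 : -(Real.pi / 2) < φ) (h2 : φ < Real.pi / 2) :
    ‖Complex.Gamma z‖ * Real.exp (φ * z.im) ≤
      Real.Gamma z.re * (Real.cos φ)⁻¹ ^ z.re := by
  have hcos : 0 < Real.cos φ := Real.cos_pos_of_mem_Ioo ⟨h1, h2⟩
  have hre : (Complex.exp (φ * Complex.I)).re = Real.cos φ := by simp [Complex.exp_re]
  have key := integral_cpow_mul_exp_neg_mul_Ioi_of_re_pos hz (hre ▸ hcos)
  have hn : ‖Complex.exp (φ * Complex.I) ^ (-z)‖ = Real.exp (φ * z.im) := by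
    rw [exp_mul_I_cpow h1 h2, Complex.norm_exp]; simp
  rw [← hn, mul_comm, ← norm_mul, ← key]
  calc _ ≤ ∫ u in Set.Ioi (0 : ℝ), u ^ (z.re - 1) * Real.exp (-(Real.cos φ * u)) := by
        refine (norm_integral_le_integral_norm _).trans_eq ?_
        refine setIntegral_congr_fun measurableSet_Ioi fun u hu => ?_
        simp only [norm_cpow_mul_exp_neg_mul (Set.mem_Ioi.1 hu), hre, Complex.sub_re,
          Complex.one_re]
    _ = _ := by rw [Real.integral_rpow_mul_exp_neg_mul_Ioi hz hcos, one_div, mul_comm]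

theorem norm_Gamma_mul_exp_mul_abs_im_le {z : ℂ} {φ : ℝ} (hz : 0 < z.re)
    (h1 : 0 ≤ φ) (h2 : φ < Real.pi / 2) :
    ‖Complex.Gamma z‖ * Real.exp (φ * |z.im|) ≤
      Real.Gamma z.re * (Real.cos φ)⁻¹ ^ z.re := by
  rcases abs_cases z.im with ⟨h, _⟩ | ⟨h, _⟩ <;> rw [h]
  · exact norm_Gamma_mul_exp_mul_im_le hz (by linarith [Real.pi_pos]) h2
  · simpa using norm_Gamma_mul_exp_mul_im_le (φ := -φ) hz (by linarith) (by linarith [Real.pi_pos])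

theorem norm_Gamma_le_rpow_mul_exp {z : ℂ} (hz : 0 < z.re) :
    ‖Complex.Gamma z‖ * Real.exp (Real.pi / 2 * |z.im|) ≤
      Real.Gamma z.re * (Real.pi / 2) ^ z.re * Real.exp 1 * (1 + |z.im|) ^ z.re := by
  set τ := |z.im|
  have hτ : 0 ≤ τ := abs_nonneg _
  have hπ := Real.pi_gt_three
  have h0 : 0 < 1 / (1 + τ) := by positivity
  have h1 : 1 / (1 + τ) ≤ 1 := (div_le_one (by positivity)).2 (by linarith)
  have hcos : (Real.cos (Real.pi / 2 - 1 / (1 + τ)))⁻¹ ≤ Real.pi / 2 * (1 + τ) := by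
    rw [Real.cos_pi_div_two_sub]
    refine inv_le_of_inv_le₀ (by positivity) (le_trans (le_of_eq ?_)
      (Real.mul_le_sin h0.le (by linarith)))
    field_simp
  have hcos0 : 0 < Real.cos (Real.pi / 2 - 1 / (1 + τ)) :=
    Real.cos_pos_of_mem_Ioo ⟨by linarith, by linarith⟩
  have hG := Real.Gamma_pos_of_pos hz
  have hexp : Real.exp (Real.pi / 2 * τ) ≤
      Real.exp ((Real.pi / 2 - 1 / (1 + τ)) * τ) * Real.exp 1 := by
    rw [← Real.exp_add, Real.exp_le_exp]
    have : 1 / (1 + τ) * τ ≤ 1 := by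
      rw [one_div_mul_eq_div]; exact (div_le_one (by positivity)).2 (by linarith)
    linarith
  calc ‖Complex.Gamma z‖ * Real.exp (Real.pi / 2 * τ)
      ≤ ‖Complex.Gamma z‖ *
          (Real.exp ((Real.pi / 2 - 1 / (1 + τ)) * τ) * Real.exp 1) := by gcongr
    _ = (‖Complex.Gamma z‖ * Real.exp ((Real.pi / 2 - 1 / (1 + τ)) * τ)) * Real.exp 1 := by ring
    _ ≤ (Real.Gamma z.re * (Real.cos (Real.pi / 2 - 1 / (1 + τ)))⁻¹ ^ z.re) * Real.exp 1 := by
        exact mul_le_mul_of_nonneg_right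
          (norm_Gamma_mul_exp_mul_abs_im_le hz (by linarith) (by linarith)) (Real.exp_nonneg _)
    _ ≤ (Real.Gamma z.re * (Real.pi / 2 * (1 + τ)) ^ z.re) * Real.exp 1 := by gcongr
    _ = _ := by rw [Real.mul_rpow (by positivity) (by positivity)]; ring

theorem continuous_Gamma_vertical {σ : ℝ} (hσ : 0 < σ) :
    Continuous fun y : ℝ => Complex.Gamma (σ + y * Complex.I) := by
  refine continuous_iff_continuousAt.2 fun y => ?_
  refine ContinuousAt.comp (g := Complex.Gamma) (Complex.continuousAt_Gamma _ fun m h => ?_)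
    (by fun_prop)
  have := congrArg Complex.re h
  simp at this
  linarith [Nat.cast_nonneg (α := ℝ) m]

theorem integrable_exp_neg_mul_abs {c : ℝ} (hc : 0 < c) :
    Integrable fun y : ℝ => Real.exp (-(c * |y|)) := by
  rw [← integrableOn_univ, ← Set.Iic_union_Ioi (a := (0 : ℝ)), integrableOn_union]
  constructor
  · refine (integrableOn_exp_mul_Iic hc 0).congr_fun (fun y hy => ?_) measurableSet_Iic
    simp [abs_of_nonpos (Set.mem_Iic.1 hy)]
  · refine (integrableOn_exp_mul_Ioi (neg_lt_zero.2 hc) 0).congr_fun (fun y hy => ?_)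
      measurableSet_Ioi
    simp [abs_of_pos (Set.mem_Ioi.1 hy)]

/-- The Mellin transform of `u ↦ exp (-e^{iθ} u)` is integrable on vertical lines. -/
theorem integrable_Gamma_mul_exp_vertical {σ θ : ℝ} (hσ : 0 < σ) (h1 : 0 ≤ θ)
    (h2 : θ < Real.pi / 2) :
    Integrable fun y : ℝ => Complex.exp (θ * Complex.I * -(σ + y * Complex.I)) *
      Complex.Gamma (σ + y * Complex.I) := by
  set φ := (θ + Real.pi / 2) / 2
  have hφ : θ < φ := by simp only [φ]; linarith
  refine ((integrable_exp_neg_mul_abs (sub_pos.2 hφ)).const_mul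
    (Real.Gamma σ * (Real.cos φ)⁻¹ ^ σ)).mono'
    (((by fun_prop : Continuous fun y : ℝ => _).mul
      (continuous_Gamma_vertical hσ)).aestronglyMeasurable) (.of_forall fun y => ?_)
  have hb := norm_Gamma_mul_exp_mul_abs_im_le (z := σ + y * Complex.I) (φ := φ) (by simpa)
    (by linarith) (by simp only [φ]; linarith)
  simp only [Complex.add_re, Complex.ofReal_re, Complex.mul_re, Complex.I_re, Complex.I_im,
    Complex.ofReal_im, Complex.add_im, Complex.mul_im, mul_zero, mul_one, sub_self, add_zero,
    zero_add] at hb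
  have hn : ‖Complex.exp (θ * Complex.I * -(σ + y * Complex.I))‖ = Real.exp (θ * y) := by
    rw [Complex.norm_exp]; simp
  rw [norm_mul, hn]
  calc _ ≤ Real.exp (θ * |y|) * ‖Complex.Gamma (σ + y * Complex.I)‖ := by
        gcongr; exact le_abs_self y
    _ = (‖Complex.Gamma (σ + y * Complex.I)‖ * Real.exp (φ * |y|)) *
          Real.exp (-((φ - θ) * |y|)) := by
        rw [mul_assoc, ← Real.exp_add, mul_comm]; ring_nf
    _ ≤ _ := by gcongr

/-- Mellin inversion for `u ↦ exp (-e^{iθ} u)`. -/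
theorem exp_neg_exp_mul_I_mul_eq_integral {σ θ u : ℝ} (hσ : 0 < σ) (h1 : 0 ≤ θ)
    (h2 : θ < Real.pi / 2) (hu : 0 < u) :
    Complex.exp (-(Complex.exp (θ * Complex.I) * u)) = (1 / (2 * Real.pi) : ℂ) *
      ∫ y : ℝ, (u : ℂ) ^ (-(σ + y * Complex.I)) *
        (Complex.exp (θ * Complex.I * -(σ + y * Complex.I)) *
          Complex.Gamma (σ + y * Complex.I)) := by
  set r := Complex.exp (θ * Complex.I) with hr
  have hre : 0 < r.re := by
    have : r.re = Real.cos θ := by simp [hr, Complex.exp_re]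
    rw [this]
    exact Real.cos_pos_of_mem_Ioo ⟨by linarith, h2⟩
  have hm (y : ℝ) : mellin (fun u : ℝ => Complex.exp (-(r * u))) (σ + y * Complex.I) =
      Complex.exp (θ * Complex.I * -(σ + y * Complex.I)) *
          Complex.Gamma (σ + y * Complex.I) := by
    rw [mellin_exp_neg_mul (by simpa) hre, exp_mul_I_cpow (by linarith) h2]
  have := mellinInv_mellin_eq σ (fun u : ℝ => Complex.exp (-(r * u))) hu
    (integrableOn_cpow_mul_exp_neg_mul (by simpa) hre)
    (by simpa only [Complex.VerticalIntegrable, hm] using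
      integrable_Gamma_mul_exp_vertical hσ h1 h2)
    (by fun_prop)
  rw [← this, mellinInv]
  simp only [hm, smul_eq_mul, Complex.real_smul]
  push_cast
  rfl

theorem SchwartzMap.isBigO_atTop_rpow (f : SchwartzMap ℝ ℂ) (a : ℝ) :
    f =O[Filter.atTop] fun x : ℝ => x ^ a := by
  refine ((f.isBigO_cocompact_rpow a).mono atTop_le_cocompact).congr' .rfl ?_
  filter_upwards [Filter.eventually_ge_atTop 0] with x hx
  rw [Real.norm_of_nonneg hx]

theorem SchwartzMap.isBigO_nhdsGT_zero (f : SchwartzMap ℝ ℂ) :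
    f =O[nhdsWithin 0 (Set.Ioi 0)] fun x : ℝ => x ^ (-0 : ℝ) := by
  simpa using ((f.continuous.tendsto 0).isBigO_one ℝ).mono nhdsWithin_le_nhds

theorem SchwartzMap.mellinConvergent (f : SchwartzMap ℝ ℂ) {w : ℂ} (hw : 0 < w.re) :
    MellinConvergent f w :=
  mellinConvergent_of_isBigO_rpow (f.continuous.locallyIntegrable.locallyIntegrableOn _)
    (f.isBigO_atTop_rpow (-(w.re + 1))) (by linarith) f.isBigO_nhdsGT_zero hw

theorem SchwartzMap.differentiableAt_mellin (f : SchwartzMap ℝ ℂ) {w : ℂ} (hw : 0 < w.re) :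
    DifferentiableAt ℂ (mellin f) w :=
  mellin_differentiableAt_of_isBigO_rpow (f.continuous.locallyIntegrable.locallyIntegrableOn _)
    (f.isBigO_atTop_rpow (-(w.re + 1))) (by linarith) f.isBigO_nhdsGT_zero hw

theorem SchwartzMap.mellin_derivCLM (f : SchwartzMap ℝ ℂ) {w : ℂ} (hw : 0 < w.re) :
    mellin (SchwartzMap.derivCLM ℝ ℂ f) (w + 1) = -(w * mellin f w) := by
  have hw0 : w ≠ 0 := fun h => by simp [h] at hw
  have hd : ∀ x ∈ Set.Ioi (0 : ℝ),
      HasDerivAt (fun x : ℝ => (x : ℂ) ^ w) (w * (x : ℂ) ^ (w - 1)) x := fun x hx => by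
    simpa using ((hasDerivAt_id (x : ℂ)).cpow_const (c := w)
      (Or.inl (by simpa using hx))).comp_ofReal
  have hi := (SchwartzMap.derivCLM ℝ ℂ f).mellinConvergent (w := w + 1) (by simp; linarith)
  have hf := f.mellinConvergent hw
  simp only [MellinConvergent, smul_eq_mul, add_sub_cancel_right] at hi hf
  have hz : Filter.Tendsto ((fun x : ℝ => (x : ℂ) ^ w) * (f : ℝ → ℂ)) (nhdsWithin 0 (Set.Ioi 0))
      (nhds 0) := by
    have h1 : Filter.Tendsto (fun x : ℝ => (x : ℂ) ^ w) (nhds 0) (nhds 0) :=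
      (Complex.continuousAt_ofReal_cpow_const 0 w (Or.inl hw)).tendsto.trans (by simp [hw0])
    have h2 := (h1.mul (f.continuous.tendsto 0)).mono_left
      (nhdsWithin_le_nhds (s := Set.Ioi 0))
    rwa [zero_mul] at h2
  have ht : Filter.Tendsto ((fun x : ℝ => (x : ℂ) ^ w) * (f : ℝ → ℂ)) Filter.atTop (nhds 0) := by
    have h1 : (fun x : ℝ => (x : ℂ) ^ w) =O[Filter.atTop] fun x : ℝ => x ^ w.re := by
      refine Asymptotics.IsBigO.of_bound 1 ?_
      filter_upwards [Filter.eventually_gt_atTop 0] with x hx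
      rw [Complex.norm_cpow_eq_rpow_re_of_pos hx, one_mul]
      exact le_abs_self _
    refine (h1.mul (f.isBigO_atTop_rpow (-w.re - 1))).trans_tendsto ?_
    refine (tendsto_rpow_neg_atTop one_pos).congr' ?_
    filter_upwards [Filter.eventually_gt_atTop 0] with x hx
    rw [← Real.rpow_add hx]
    ring_nf
  have key := integral_Ioi_mul_deriv_eq_deriv_mul hd (fun x _ => f.hasDerivAt x) hi
    ((hf.const_mul w).congr (.of_forall fun x => (mul_assoc _ _ _).symm)) hz ht
  simp only [mellin, smul_eq_mul, add_sub_cancel_right, SchwartzMap.derivCLM_apply, key,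
    mul_assoc, integral_const_mul]
  ring

theorem norm_mellin_le (f : ℝ → ℂ) (w : ℂ) :
    ‖mellin f w‖ ≤ ∫ u in Set.Ioi (0 : ℝ), u ^ (w.re - 1) * ‖f u‖ := by
  refine (norm_integral_le_integral_norm _).trans_eq
    (setIntegral_congr_fun measurableSet_Ioi fun u hu => ?_)
  simp [Complex.norm_cpow_eq_rpow_re_of_pos (Set.mem_Ioi.1 hu)]

theorem one_add_abs_im_le {ρ : ℝ} (hρ : 0 < ρ) {w : ℂ} (hw : ρ ≤ w.re) :
    1 + |w.im| ≤ (ρ⁻¹ + 1) * ‖w‖ := by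
  have h1 : ρ ≤ ‖w‖ := hw.trans (Complex.re_le_norm w)
  have h2 : 1 ≤ ρ⁻¹ * ‖w‖ := by rwa [inv_mul_eq_div, one_le_div hρ]
  linarith [Complex.abs_im_le_norm w]

/-- The Mellin transform of a Schwartz function decays quadratically on vertical lines. -/
theorem SchwartzMap.exists_norm_mellin_le (f : SchwartzMap ℝ ℂ) {ρ : ℝ} (hρ : 0 < ρ) :
    ∃ C, 0 ≤ C ∧ ∀ w : ℂ, w.re = ρ → ‖mellin f w‖ ≤ C * (1 + |w.im|) ^ (-2 : ℝ) := by
  set g := SchwartzMap.derivCLM ℝ ℂ (SchwartzMap.derivCLM ℝ ℂ f)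
  have hM : 0 ≤ ∫ u in Set.Ioi (0 : ℝ), u ^ (ρ + 1) * ‖g u‖ :=
    setIntegral_nonneg measurableSet_Ioi fun u (hu : 0 < u) => by positivity
  refine ⟨(ρ⁻¹ + 1) ^ 2 * ∫ u in Set.Ioi (0 : ℝ), u ^ (ρ + 1) * ‖g u‖, by positivity,
    fun w hw => ?_⟩
  have hwpos : 0 < w.re := hw ▸ hρ
  have hg : mellin g (w + 1 + 1) = (w + 1) * (w * mellin f w) := by
    rw [SchwartzMap.mellin_derivCLM _ (by simp; linarith), f.mellin_derivCLM hwpos]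
    ring
  have hle := norm_mellin_le g (w + 1 + 1)
  have hre : (w + 1 + 1).re - 1 = ρ + 1 := by simp [hw]
  rw [hg, norm_mul, norm_mul, hre] at hle
  have h1 := one_add_abs_im_le hρ hw.ge
  have h2 := one_add_abs_im_le hρ (w := w + 1) (by simp; linarith)
  simp only [Complex.add_im, Complex.one_im, add_zero] at h2
  rw [Real.rpow_neg (by positivity), Real.rpow_two, ← div_eq_mul_inv, le_div_iff₀ (by positivity)]
  calc ‖mellin f w‖ * (1 + |w.im|) ^ 2 = ‖mellin f w‖ * ((1 + |w.im|) * (1 + |w.im|)) := by ring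
    _ ≤ ‖mellin f w‖ * (((ρ⁻¹ + 1) * ‖w‖) * ((ρ⁻¹ + 1) * ‖w + 1‖)) := by gcongr
    _ = (ρ⁻¹ + 1) ^ 2 * (‖w + 1‖ * (‖w‖ * ‖mellin f w‖)) := by ring
    _ ≤ _ := by gcongr

theorem SchwartzMap.integral_mul_exp_neg_exp_mul_I_mul (f : SchwartzMap ℝ ℂ) {σ θ : ℝ}
    (hσ : 0 < σ) (hσ1 : σ < 1) (h1 : 0 ≤ θ) (h2 : θ < Real.pi / 2) :
    ∫ u in Set.Ioi (0 : ℝ), f u * Complex.exp (-(Complex.exp (θ * Complex.I) * u)) =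
      (1 / (2 * Real.pi) : ℂ) * ∫ y : ℝ,
        Complex.exp (θ * Complex.I * -(σ + y * Complex.I)) * Complex.Gamma (σ + y * Complex.I) *
          mellin f (1 - (σ + y * Complex.I)) := by
  have hG := integrable_Gamma_mul_exp_vertical hσ h1 h2
  set G : ℝ → ℂ := fun y =>
    Complex.exp (θ * Complex.I * -(σ + y * Complex.I)) * Complex.Gamma (σ + y * Complex.I)
  have hf : Integrable (fun u : ℝ => (u : ℂ) ^ (-σ : ℂ) * f u) (volume.restrict (Set.Ioi 0)) := by
    have := f.mellinConvergent (w := 1 - σ) (by simp [hσ1])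
    simpa [MellinConvergent, IntegrableOn] using this
  have hint : Integrable (Function.uncurry fun u y : ℝ =>
      f u * ((u : ℂ) ^ (-(σ + y * Complex.I)) * G y))
      ((volume.restrict (Set.Ioi 0)).prod volume) := by
    refine (hf.mul_prod hG).mono ?_ ?_
    · refine (f.continuous.measurable.comp measurable_fst).aestronglyMeasurable.mul
        (Measurable.aestronglyMeasurable (by fun_prop) |>.mul hG.aestronglyMeasurable.comp_snd)
    · have hpos : ∀ᵐ p ∂(volume.restrict (Set.Ioi (0 : ℝ))).prod (volume : Measure ℝ),
          0 < p.1 :=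
        Measure.quasiMeasurePreserving_fst.ae (ae_restrict_mem measurableSet_Ioi)
      filter_upwards [hpos] with p hp
      simp only [Function.uncurry, norm_mul, Complex.norm_cpow_eq_rpow_re_of_pos hp]
      simp
      apply le_of_eq
      ring
  calc _ = ∫ u in Set.Ioi (0 : ℝ), (1 / (2 * Real.pi) : ℂ) *
        ∫ y : ℝ, f u * ((u : ℂ) ^ (-(σ + y * Complex.I)) * G y) :=
        setIntegral_congr_fun measurableSet_Ioi fun u hu => by
          simp only [exp_neg_exp_mul_I_mul_eq_integral hσ h1 h2 hu, integral_const_mul, G]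
          ring
    _ = (1 / (2 * Real.pi) : ℂ) * ∫ y : ℝ, ∫ u in Set.Ioi (0 : ℝ),
        f u * ((u : ℂ) ^ (-(σ + y * Complex.I)) * G y) := by
        rw [integral_const_mul, integral_integral_swap hint]
    _ = _ := by
        congr 2 with y
        rw [mellin, ← integral_const_mul]
        congr 1 with u
        rw [sub_sub_cancel_left, smul_eq_mul]
        ring

theorem norm_exp_mul_Gamma_mul_mellin_le (f : ℝ → ℂ) {σ θ C : ℝ}
    (hσ : 0 < σ) (h1 : 0 ≤ θ) (h2 : θ ≤ Real.pi / 2)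
    (hC : ∀ w : ℂ, w.re = 1 - σ → ‖mellin f w‖ ≤ C * (1 + |w.im|) ^ (-2 : ℝ)) (y : ℝ) :
    ‖Complex.exp (θ * Complex.I * -(σ + y * Complex.I)) * Complex.Gamma (σ + y * Complex.I) *
        mellin f (1 - (σ + y * Complex.I))‖ ≤
      Real.Gamma σ * (Real.pi / 2) ^ σ * Real.exp 1 * C * (1 + |y|) ^ (-(2 - σ)) := by
  have hΓ := norm_Gamma_le_rpow_mul_exp (z := σ + y * Complex.I) (by simpa using hσ)
  have hM := hC (1 - (σ + y * Complex.I)) (by simp)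
  have hE : ‖Complex.exp (θ * Complex.I * -(σ + y * Complex.I))‖ ≤
      Real.exp (Real.pi / 2 * |y|) := by
    rw [Complex.norm_exp, Real.exp_le_exp]
    simp only [Complex.mul_re, Complex.mul_im, Complex.neg_re, Complex.neg_im, Complex.add_re,
      Complex.add_im, Complex.ofReal_re, Complex.ofReal_im, Complex.I_re, Complex.I_im]
    nlinarith [le_abs_self y, abs_nonneg y]
  simp at hΓ hM
  have hG0 := (Real.Gamma_pos_of_pos hσ).le
  have hpi := Real.pi_pos
  rw [norm_mul, norm_mul]
  calc _ ≤ (Real.exp (Real.pi / 2 * |y|) * ‖Complex.Gamma (σ + y * Complex.I)‖) *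
        (C * (1 + |y|) ^ (-2 : ℝ)) := by
        gcongr
        simpa using hM
    _ = (‖Complex.Gamma (σ + y * Complex.I)‖ * Real.exp (Real.pi / 2 * |y|)) *
        (C * (1 + |y|) ^ (-2 : ℝ)) := by ring
    _ ≤ (Real.Gamma σ * (Real.pi / 2) ^ σ * Real.exp 1 * (1 + |y|) ^ σ) *
        (C * (1 + |y|) ^ (-2 : ℝ)) := by
        have : 0 ≤ C * (1 + |y|) ^ (-2 : ℝ) := (norm_nonneg _).trans (by simpa using hM)
        gcongr
    _ = _ := by
        rw [show -(2 - σ) = σ + (-2) by ring, Real.rpow_add (by positivity)]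
        ring

theorem integrable_one_add_abs_rpow {σ : ℝ} (hσ1 : σ < 1) (K : ℝ) :
    Integrable fun y : ℝ => K * (1 + |y|) ^ (-(2 - σ)) :=
  (integrable_one_add_norm (by simp; linarith)).const_mul K

theorem SchwartzMap.continuous_exp_mul_Gamma_mul_mellin (f : SchwartzMap ℝ ℂ) {σ : ℝ}
    (hσ : 0 < σ) (hσ1 : σ < 1) (θ : ℝ) :
    Continuous fun y : ℝ =>
      Complex.exp (θ * Complex.I * -(σ + y * Complex.I)) * Complex.Gamma (σ + y * Complex.I) *
        mellin f (1 - (σ + y * Complex.I)) := by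
  refine (Continuous.mul (by fun_prop) (continuous_Gamma_vertical hσ)).mul ?_
  refine continuous_iff_continuousAt.2 fun y => ?_
  exact ContinuousAt.comp (g := mellin f) (f := fun y : ℝ => 1 - (σ + y * Complex.I))
    (f.differentiableAt_mellin (by simp [hσ1])).continuousAt (by fun_prop)

theorem SchwartzMap.integrable_exp_mul_Gamma_mul_mellin (f : SchwartzMap ℝ ℂ) {σ θ : ℝ}
    (hσ : 0 < σ) (hσ1 : σ < 1) (h1 : 0 ≤ θ) (h2 : θ ≤ Real.pi / 2) :
    Integrable fun y : ℝ =>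
      Complex.exp (θ * Complex.I * -(σ + y * Complex.I)) * Complex.Gamma (σ + y * Complex.I) *
        mellin f (1 - (σ + y * Complex.I)) := by
  obtain ⟨C, -, hC⟩ := f.exists_norm_mellin_le (ρ := 1 - σ) (by linarith)
  exact (integrable_one_add_abs_rpow hσ1 _).mono'
    (f.continuous_exp_mul_Gamma_mul_mellin hσ hσ1 θ).aestronglyMeasurable
    (.of_forall (norm_exp_mul_Gamma_mul_mellin_le f hσ h1 h2 hC))

theorem SchwartzMap.integral_mul_exp_neg_I_mul (f : SchwartzMap ℝ ℂ) {σ : ℝ}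
    (hσ : 0 < σ) (hσ1 : σ < 1) :
    ∫ u in Set.Ioi (0 : ℝ), f u * Complex.exp (-Complex.I * u) =
      (1 / (2 * Real.pi) : ℂ) * ∫ y : ℝ,
        Complex.exp ((Real.pi / 2 : ℝ) * Complex.I * -(σ + y * Complex.I)) *
          Complex.Gamma (σ + y * Complex.I) * mellin f (1 - (σ + y * Complex.I)) := by
  obtain ⟨C, -, hC⟩ := f.exists_norm_mellin_le (ρ := 1 - σ) (by linarith)
  have hpi : 0 < Real.pi / 2 := by positivity
  have hmem : ∀ᶠ θ in nhdsWithin (Real.pi / 2) (Set.Iio (Real.pi / 2)), 0 ≤ θ ∧ θ < Real.pi / 2 :=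
    Filter.mem_of_superset (Ioo_mem_nhdsLT hpi) fun θ hθ => ⟨hθ.1.le, hθ.2⟩
  have hleft : Filter.Tendsto
      (fun θ : ℝ => ∫ u in Set.Ioi (0 : ℝ), f u * Complex.exp (-(Complex.exp (θ * Complex.I) * u)))
      (nhdsWithin (Real.pi / 2) (Set.Iio (Real.pi / 2)))
      (nhds (∫ u in Set.Ioi (0 : ℝ), f u * Complex.exp (-Complex.I * u))) := by
    refine tendsto_integral_filter_of_dominated_convergence (fun u => ‖f u‖) ?_ ?_
      f.integrable.norm.integrableOn ?_
    · exact .of_forall fun θ => Continuous.aestronglyMeasurable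
        (f.continuous.mul (by fun_prop))
    · filter_upwards [hmem] with θ hθ
      filter_upwards [ae_restrict_mem measurableSet_Ioi] with u hu
      have hcos : 0 ≤ Real.cos θ := Real.cos_nonneg_of_mem_Icc ⟨by linarith, hθ.2.le⟩
      have hu' : 0 < u := hu
      rw [norm_mul, Complex.norm_exp]
      refine mul_le_of_le_one_right (norm_nonneg _) (Real.exp_le_one_iff.2 ?_)
      simp [Complex.exp_ofReal_mul_I_re]
      positivity
    · refine .of_forall fun u => ?_
      have hc : Continuous fun θ : ℝ => f u * Complex.exp (-(Complex.exp (θ * Complex.I) * u)) := by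
        fun_prop
      have h := (hc.tendsto (Real.pi / 2)).mono_left
        (nhdsWithin_le_nhds (s := Set.Iio (Real.pi / 2)))
      rw [Complex.ofReal_div, Complex.ofReal_ofNat, Complex.exp_pi_div_two_mul_I, ← neg_mul] at h
      exact h
  refine tendsto_nhds_unique_of_eventuallyEq hleft (Filter.Tendsto.const_mul _ ?_)
    (hmem.mono fun θ hθ => f.integral_mul_exp_neg_exp_mul_I_mul hσ hσ1 hθ.1 hθ.2)
  refine tendsto_integral_filter_of_dominated_convergence _
    (.of_forall fun θ =>
      (f.continuous_exp_mul_Gamma_mul_mellin hσ hσ1 θ).aestronglyMeasurable)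
    (hmem.mono fun θ hθ =>
      .of_forall (norm_exp_mul_Gamma_mul_mellin_le f hσ hθ.1 hθ.2.le hC))
    (integrable_one_add_abs_rpow hσ1 _) (.of_forall fun y => ?_)
  refine ((Continuous.tendsto ?_ _).mono_left nhdsWithin_le_nhds)
  fun_prop

theorem integral_mul_exp_mul_log_add (f : ℝ → ℂ) (z : ℂ) :
    ∫ u in Set.Ioi (0 : ℝ), f u *
        Complex.exp (-z * ((Real.log u : ℂ) + Complex.I * (Real.pi : ℂ) / 2)) =
      Complex.exp ((Real.pi / 2 : ℝ) * Complex.I * -z) * mellin f (1 - z) := by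
  rw [mellin, ← integral_const_mul]
  refine setIntegral_congr_fun measurableSet_Ioi fun u (hu : 0 < u) => ?_
  have hu0 : (u : ℂ) ≠ 0 := by exact_mod_cast hu.ne'
  simp only [sub_sub_cancel_left, smul_eq_mul, Complex.cpow_def_of_ne_zero hu0,
    Complex.ofReal_log hu.le]
  rw [← mul_assoc, ← Complex.exp_add, mul_comm]
  congr 2
  push_cast
  ring

/-- smeared distributional Mellin representation of `e^{−iu}χ(u)`:
for Schwartz `f` and `s ∈ (−1,0)`,
`∫₀^∞ f(u) e^{−iu} du = (1/2π) ∫_ℝ Γ(−s−it) (∫₀^∞ f(u) (iu)^{s+it} du) dt`,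
the outer integral converging absolutely. -/
theorem stmt13 (f : SchwartzMap ℝ ℂ) (s : ℝ) (hs1 : -1 < s) (hs2 : s < 0) :
    Integrable (fun t : ℝ =>
      Complex.Gamma (-(s : ℂ) - (t : ℂ) * Complex.I) *
        ∫ u in Set.Ioi (0 : ℝ), f u *
          Complex.exp (((s : ℂ) + (t : ℂ) * Complex.I) *
            ((Real.log u : ℂ) + Complex.I * (Real.pi : ℂ) / 2))) ∧
    (∫ u in Set.Ioi (0 : ℝ), f u * Complex.exp (-Complex.I * (u : ℂ))) =
      (1 / (2 * (Real.pi : ℂ))) *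
        ∫ t : ℝ,
          Complex.Gamma (-(s : ℂ) - (t : ℂ) * Complex.I) *
            ∫ u in Set.Ioi (0 : ℝ), f u *
              Complex.exp (((s : ℂ) + (t : ℂ) * Complex.I) *
                ((Real.log u : ℂ) + Complex.I * (Real.pi : ℂ) / 2)) := by
  have hσ : 0 < -s := by linarith
  have hσ1 : -s < 1 := by linarith
  have hcongr : ∀ t : ℝ, Complex.Gamma (-(s : ℂ) - (t : ℂ) * Complex.I) *
      ∫ u in Set.Ioi (0 : ℝ), f u * Complex.exp (((s : ℂ) + (t : ℂ) * Complex.I) *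
        ((Real.log u : ℂ) + Complex.I * (Real.pi : ℂ) / 2)) =
      (fun y : ℝ => Complex.exp ((Real.pi / 2 : ℝ) * Complex.I * -((-s : ℝ) + y * Complex.I)) *
        Complex.Gamma ((-s : ℝ) + y * Complex.I) *
          mellin f (1 - ((-s : ℝ) + y * Complex.I))) (-t) := fun t => by
    have hz : (s : ℂ) + t * Complex.I = -((-s : ℝ) + (-t : ℝ) * Complex.I) := by
      push_cast
      ring
    have hz' : -(s : ℂ) - t * Complex.I = (-s : ℝ) + (-t : ℝ) * Complex.I := by
      push_cast
      ring
    rw [hz, hz', integral_mul_exp_mul_log_add]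
    ring
  simp only [hcongr]
  refine ⟨(f.integrable_exp_mul_Gamma_mul_mellin hσ hσ1 (by positivity) le_rfl).comp_neg, ?_⟩
  rw [f.integral_mul_exp_neg_I_mul hσ hσ1, ← integral_neg_eq_self]
end

section
/- Let 0 < Ω < 1, C = (1−Ω)²/(4Ω) and β = C(1+Ω)/(1−Ω) = (1−Ω²)/(4Ω). For natural numbers m, l, h and α ∈ (0,1) define K_{m,h,l}(α) = Σ_{u=0}^{min(m,l)} A(m,l,h,u) β^{m+l−2u} (1−α)^{(h+2u+1)/2} α^{m+l−2u} / (1+Cα)^{m+l+h+1}. Then for every α ∈ (0,1) and all m, l, h ∈ ℕ: −(1−α) (d/dα) K_{m,h,l}(α) = ((1+Ω²)/(4Ω)) (2m+h+1) K_{m,h,l}(α) − ((1−Ω²)/(4Ω)) [ √(m(m+h)) K_{m−1,h,l}(α) + √((m+1)(m+h+1)) K_{m+1,h,l}(α) ], with the convention that the K_{m−1,h,l} term is absent for m = 0 (its coefficient √(m(m+h)) then vanishes). -/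
/-- The combinatorial coefficient
`A(m,l,h,u) = √(m!(m+h)!l!(l+h)!)/((m−u)!(l−u)!(h+u)!u!)`. -/
noncomputable def Acoef (m l h u : ℕ) : ℝ :=
  Real.sqrt ((m.factorial * (m + h).factorial * l.factorial * (l + h).factorial : ℕ)) /
    (((m - u).factorial * (l - u).factorial * (h + u).factorial * u.factorial : ℕ) : ℝ)

/-- The matrix element `K_{m,h,l}(α)` of the vulcanized Φ⋆⁴ propagator, with
`C = (1−Ω)²/(4Ω)` and `β = (1−Ω²)/(4Ω)`:
`K_{m,h,l}(α) = Σ_{u=0}^{min(m,l)} A(m,l,h,u) β^{m+l−2u} (1−α)^{(h+2u+1)/2} α^{m+l−2u}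
  / (1+Cα)^{m+l+h+1}`. -/
noncomputable def Kfun (Ω : ℝ) (m h l : ℕ) (α : ℝ) : ℝ :=
  ∑ u ∈ Finset.range (min m l + 1),
    Acoef m l h u * ((1 - Ω ^ 2) / (4 * Ω)) ^ (m + l - 2 * u) *
      (1 - α) ^ (((h : ℝ) + 2 * (u : ℝ) + 1) / 2) * α ^ (m + l - 2 * u) /
      (1 + (1 - Ω) ^ 2 / (4 * Ω) * α) ^ (m + l + h + 1)

open Finset

/-- `Acoef` extended by zero outside `u ≤ min m l`. -/
noncomputable def AcoefExt (m l h u : ℕ) : ℝ :=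
  if u ≤ m ∧ u ≤ l then Acoef m l h u else 0

/-- The `α`-dependent factor of the `u`-th summand of `Kfun`, with the power of `β * α` split as
`(β α) ^ (m + l) / (β α) ^ (2 u)`. -/
noncomputable def kernelTerm (C β : ℝ) (m l h u : ℕ) (α : ℝ) : ℝ :=
  (β * α) ^ (m + l) * (1 - α) ^ (((h : ℝ) + 1) / 2) * ((1 - α) / (β * α) ^ 2) ^ u /
    (1 + C * α) ^ (m + l + h + 1)

theorem sqrt_mul_Acoef_pred (m l h u : ℕ) (hu : u ≤ m) :
    √((((m + 1) * (m + 1 + h) : ℕ)) : ℝ) * Acoef m l h u =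
      ((m : ℝ) + 1 - u) * Acoef (m + 1) l h u := by
  obtain ⟨k, rfl⟩ := Nat.exists_eq_add_of_le hu
  have e1 : u + k + 1 - u = k + 1 := by omega
  have e2 : u + k - u = k := by omega
  have e3 : u + k + 1 + h = (u + k + h) + 1 := by omega
  unfold Acoef
  rw [e1, e2, e3, mul_div_assoc', ← Real.sqrt_mul (Nat.cast_nonneg _), ← Nat.cast_mul]
  have e4 : (u + k + 1) * (u + k + h + 1) *
      ((u + k).factorial * (u + k + h).factorial * l.factorial * (l + h).factorial) =
      (u + k + 1).factorial * (u + k + h + 1).factorial * l.factorial * (l + h).factorial := by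
    simp only [Nat.factorial_succ]; ring
  rw [e4, Nat.factorial_succ k]
  have := Nat.factorial_ne_zero k
  have := Nat.factorial_ne_zero (l - u)
  have := Nat.factorial_ne_zero (h + u)
  have := Nat.factorial_ne_zero u
  have : (k : ℝ) + 1 ≠ 0 := by positivity
  push_cast
  field_simp
  ring

theorem sqrt_mul_AcoefExt_pred (m l h u : ℕ) :
    √((((m + 1) * (m + 1 + h) : ℕ)) : ℝ) * AcoefExt m l h u =
      ((m : ℝ) + 1 - u) * AcoefExt (m + 1) l h u := by
  unfold AcoefExt
  by_cases hl : u ≤ l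
  · rcases lt_trichotomy u (m + 1) with hu | hu | hu
    · simp only [hl, show u ≤ m by omega, show u ≤ m + 1 by omega, and_self, if_true]
      exact sqrt_mul_Acoef_pred m l h u (by omega)
    · subst hu; simp
    · simp [show ¬ u ≤ m by omega, show ¬ u ≤ m + 1 by omega]
  · simp [hl]

theorem sqrt_factorial_succ (m l h : ℕ) :
    √((((m + 1) * (m + h + 1) : ℕ)) : ℝ) *
      √(((m + 1).factorial * (m + 1 + h).factorial * l.factorial * (l + h).factorial : ℕ) : ℝ) =
    ((m : ℝ) + 1) * (m + h + 1) *
      √((m.factorial * (m + h).factorial * l.factorial * (l + h).factorial : ℕ) : ℝ) := by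
  have e : (m + 1).factorial * (m + 1 + h).factorial * l.factorial * (l + h).factorial =
      ((m + 1) * (m + h + 1)) *
        (m.factorial * (m + h).factorial * l.factorial * (l + h).factorial) := by
    rw [show m + 1 + h = m + h + 1 by omega]
    simp only [Nat.factorial_succ]; ring
  rw [e, Nat.cast_mul ((m + 1) * (m + h + 1)), Real.sqrt_mul (Nat.cast_nonneg _), ← mul_assoc,
    Real.mul_self_sqrt (Nat.cast_nonneg _)]
  push_cast
  ring

theorem sqrt_mul_AcoefExt_succ_zero (m l h : ℕ) :
    √((((m + 1) * (m + h + 1) : ℕ)) : ℝ) * AcoefExt (m + 1) l h 0 =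
      ((m : ℝ) + 1 + h) * AcoefExt m l h 0 := by
  simp only [AcoefExt, Nat.zero_le, and_self, if_true, Acoef, Nat.sub_zero]
  rw [mul_div_assoc', sqrt_factorial_succ, Nat.factorial_succ m]
  have := Nat.factorial_ne_zero m
  have := Nat.factorial_ne_zero l
  have := Nat.factorial_ne_zero h
  have : (m : ℝ) + 1 ≠ 0 := by positivity
  push_cast
  simp only [add_zero]
  field_simp
  ring

theorem sqrt_mul_AcoefExt_succ_succ (m l h v : ℕ) :
    √((((m + 1) * (m + h + 1) : ℕ)) : ℝ) * AcoefExt (m + 1) l h (v + 1) =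
      ((m : ℝ) + 1 + h + (v + 1)) * AcoefExt m l h (v + 1) + ((l : ℝ) - v) * AcoefExt m l h v := by
  unfold AcoefExt
  rcases lt_trichotomy v l with hl | rfl | hl
  · obtain ⟨j, rfl⟩ := Nat.exists_eq_add_of_lt hl
    rcases lt_trichotomy v m with hm | rfl | hm
    · obtain ⟨k, rfl⟩ := Nat.exists_eq_add_of_lt hm
      simp only [show v + 1 ≤ v + k + 1 + 1 by omega, show v + 1 ≤ v + k + 1 by omega,
        show v + 1 ≤ v + j + 1 by omega, show v ≤ v + k + 1 by omega,
        show v ≤ v + j + 1 by omega, and_self, if_true, Acoef]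
      rw [mul_div_assoc', sqrt_factorial_succ, show v + k + 1 + 1 - (v + 1) = k + 1 by omega,
        show v + k + 1 - (v + 1) = k by omega, show v + k + 1 - v = k + 1 by omega,
        show v + j + 1 - (v + 1) = j by omega, show v + j + 1 - v = j + 1 by omega,
        show h + (v + 1) = h + v + 1 by omega, Nat.factorial_succ k, Nat.factorial_succ j,
        Nat.factorial_succ (h + v), Nat.factorial_succ v]
      have := Nat.factorial_ne_zero k
      have := Nat.factorial_ne_zero j
      have := Nat.factorial_ne_zero v
      have := Nat.factorial_ne_zero (h + v)
      have : (k : ℝ) + 1 ≠ 0 := by positivity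
      have : (j : ℝ) + 1 ≠ 0 := by positivity
      have : (v : ℝ) + 1 ≠ 0 := by positivity
      have : (h : ℝ) + v + 1 ≠ 0 := by positivity
      push_cast
      field_simp
      ring
    · simp only [le_refl, show ¬ v + 1 ≤ v by omega, show v + 1 ≤ v + j + 1 by omega,
        show v ≤ v + j + 1 by omega, and_self, false_and, if_true, if_false, Acoef]
      rw [mul_div_assoc', sqrt_factorial_succ,
        show v + j + 1 - (v + 1) = j by omega, show v + j + 1 - v = j + 1 by omega,
        show h + (v + 1) = h + v + 1 by omega, Nat.factorial_succ j,
        Nat.factorial_succ (h + v), Nat.factorial_succ v, Nat.sub_self, Nat.sub_self]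
      have := Nat.factorial_ne_zero j
      have := Nat.factorial_ne_zero v
      have := Nat.factorial_ne_zero (h + v)
      have : (j : ℝ) + 1 ≠ 0 := by positivity
      have : (v : ℝ) + 1 ≠ 0 := by positivity
      have : (h : ℝ) + v + 1 ≠ 0 := by positivity
      push_cast
      field_simp
      ring
    · simp [show ¬ v ≤ m by omega, show ¬ v + 1 ≤ m by omega]
  · simp
  · simp [show ¬ v ≤ l by omega, show ¬ v + 1 ≤ l by omega]

theorem Kfun_eq_sum_kernelTerm {Ω α : ℝ} (hΩ0 : 0 < Ω) (hΩ1 : Ω < 1) (hα0 : 0 < α) (hα1 : α < 1)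
    (m h l : ℕ) :
    Kfun Ω m h l α = ∑ u ∈ range (l + 1), AcoefExt m l h u *
      kernelTerm ((1 - Ω) ^ 2 / (4 * Ω)) ((1 - Ω ^ 2) / (4 * Ω)) m l h u α := by
  have hβ : (1 - Ω ^ 2) / (4 * Ω) ≠ 0 := by
    have : 0 < 1 - Ω ^ 2 := by nlinarith
    positivity
  have hs : 0 < 1 - α := by linarith
  unfold Kfun
  rw [← sum_subset (range_mono (show min m l + 1 ≤ l + 1 by omega))]
  · refine sum_congr rfl fun u hu => ?_
    have hu' : u ≤ m ∧ u ≤ l := by rw [mem_range] at hu; omega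
    rw [AcoefExt, if_pos hu', kernelTerm]
    generalize (1 - Ω ^ 2) / (4 * Ω) = β at *
    have hpow : (1 - α) ^ (((h : ℝ) + 2 * (u : ℝ) + 1) / 2) =
        (1 - α) ^ (((h : ℝ) + 1) / 2) * (1 - α) ^ u := by
      rw [← Real.rpow_add_natCast hs.ne']
      congr 1
      ring
    have hsplit : (β * α) ^ (m + l) = (β * α) ^ (m + l - 2 * u) * ((β * α) ^ 2) ^ u := by
      rw [← pow_mul, ← pow_add]
      congr 1
      omega
    have hne : ((β * α) ^ 2) ^ u ≠ 0 := by positivity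
    rw [hpow, hsplit, div_pow, mul_pow β α (m + l - 2 * u)]
    generalize ((β * α) ^ 2) ^ u = y at *
    field_simp
  · intro u hu hu'
    rw [mem_range] at hu hu'
    rw [AcoefExt, if_neg (by omega), zero_mul]

theorem hasDerivAt_kernelTerm {C β α : ℝ} (hβ : β ≠ 0) (hα0 : 0 < α) (hα1 : α < 1)
    (hq : 1 + C * α ≠ 0) (m l h u : ℕ) :
    HasDerivAt (kernelTerm C β m l h u)
      (kernelTerm C β m l h u α * (((m : ℝ) + l - 2 * u) / α - ((h : ℝ) + 1 + 2 * u) / 2 / (1 - α)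
        - ((m : ℝ) + l + h + 1) * C / (1 + C * α))) α := by
  have hs : 0 < 1 - α := by linarith
  have hs' : 1 - α ≠ 0 := hs.ne'
  have hα : α ≠ 0 := hα0.ne'
  have natPow : ∀ (f : ℝ → ℝ) (f' : ℝ) (n : ℕ), f α ≠ 0 → HasDerivAt f f' α →
      HasDerivAt (fun x => f x ^ n) (f α ^ n * (n * (f' / f α))) α := by
    intro f f' n hf hd
    refine (hd.fun_pow n).congr_deriv ?_
    rcases n with _ | n
    · simp
    · rw [Nat.add_sub_cancel, pow_succ]
      field_simp
  have d1 : HasDerivAt (fun x : ℝ => β * x) β α := by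
    simpa using (hasDerivAt_id α).const_mul β
  have d2 : HasDerivAt (fun x : ℝ => 1 - x) (-1) α := by
    simpa using (hasDerivAt_id α).const_sub 1
  have d3 : HasDerivAt (fun x : ℝ => 1 + C * x) C α := by
    simpa using ((hasDerivAt_id α).const_mul C).const_add 1
  have p1 := natPow _ _ (m + l) (mul_ne_zero hβ hα) d1
  have p2 : HasDerivAt (fun x : ℝ => (1 - x) ^ (((h : ℝ) + 1) / 2))
      ((1 - α) ^ (((h : ℝ) + 1) / 2) * (((h : ℝ) + 1) / 2 * (-1 / (1 - α)))) α := by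
    refine (d2.rpow_const (Or.inl hs')).congr_deriv ?_
    rw [Real.rpow_sub_one hs']
    ring
  have p3 := natPow (fun x => (1 - x) / (β * x) ^ 2) _ u (div_ne_zero hs' (pow_ne_zero 2 (mul_ne_zero hβ hα)))
    (d2.fun_div (d1.fun_pow 2) (pow_ne_zero 2 (mul_ne_zero hβ hα)))
  have p4 := natPow _ _ (m + l + h + 1) hq d3
  refine (((p1.fun_mul p2).fun_mul p3).fun_div p4 (pow_ne_zero _ hq)).congr_deriv ?_
  unfold kernelTerm
  have hq4 : (1 + C * α) ^ (m + l + h + 1) ≠ 0 := pow_ne_zero _ hq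
  generalize (1 + C * α) ^ (m + l + h + 1) = Q at *
  generalize ((1 - α) / (β * α) ^ 2) ^ u = X
  generalize (β * α) ^ (m + l) = Y
  generalize (1 - α) ^ (((h : ℝ) + 1) / 2) = Z
  generalize 1 + C * α = q at *
  push_cast
  field_simp
  ring

theorem kernelTerm_succ_left (C β α : ℝ) (m l h u : ℕ) :
    kernelTerm C β (m + 1) l h u α =
      kernelTerm C β m l h u α * (β * α / (1 + C * α)) := by
  unfold kernelTerm
  rw [show m + 1 + l = m + l + 1 by omega, show m + l + 1 + h + 1 = m + l + h + 1 + 1 by omega,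
    pow_succ (β * α), pow_succ (1 + C * α)]
  field_simp

theorem kernelTerm_succ_right (C β α : ℝ) (m l h u : ℕ) :
    kernelTerm C β m l h (u + 1) α =
      kernelTerm C β m l h u α * ((1 - α) / (β * α) ^ 2) := by
  unfold kernelTerm
  rw [pow_succ]
  ring

theorem sqrt_mul_sum_pred {C β α : ℝ} (hβ : β ≠ 0) (hα : α ≠ 0) (hq : 1 + C * α ≠ 0)
    (m l h : ℕ) :
    √(((m * (m + h) : ℕ)) : ℝ) *
        ∑ u ∈ range (l + 1), AcoefExt (m - 1) l h u * kernelTerm C β (m - 1) l h u α =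
      ∑ u ∈ range (l + 1), AcoefExt m l h u * kernelTerm C β m l h u α *
        (((m : ℝ) - u) * ((1 + C * α) / (β * α))) := by
  rcases m with _ | m
  · rw [Nat.zero_mul, Nat.cast_zero, Real.sqrt_zero, zero_mul]
    refine (sum_eq_zero fun u _ => ?_).symm
    rcases u with _ | u <;> simp [AcoefExt]
  · rw [mul_sum]
    refine sum_congr rfl fun u _ => ?_
    rw [Nat.add_sub_cancel, ← mul_assoc, sqrt_mul_AcoefExt_pred, kernelTerm_succ_left]
    generalize 1 + C * α = q at *
    push_cast
    field_simp

theorem sqrt_mul_sum_succ (C β α : ℝ) (m l h : ℕ) :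
    √((((m + 1) * (m + h + 1) : ℕ)) : ℝ) *
        ∑ u ∈ range (l + 1), AcoefExt (m + 1) l h u * kernelTerm C β (m + 1) l h u α =
      ∑ u ∈ range (l + 1), AcoefExt m l h u * kernelTerm C β m l h u α *
        ((((m : ℝ) + 1 + h + u) + ((l : ℝ) - u) * ((1 - α) / (β * α) ^ 2)) *
          (β * α / (1 + C * α))) := by
  have hsplit : ∀ u, AcoefExt m l h u * kernelTerm C β m l h u α *
      ((((m : ℝ) + 1 + h + u) + ((l : ℝ) - u) * ((1 - α) / (β * α) ^ 2)) *
        (β * α / (1 + C * α))) =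
      ((m : ℝ) + 1 + h + u) * AcoefExt m l h u * kernelTerm C β (m + 1) l h u α +
      ((l : ℝ) - u) * AcoefExt m l h u * kernelTerm C β (m + 1) l h (u + 1) α := by
    intro u
    rw [kernelTerm_succ_right, kernelTerm_succ_left]
    ring
  rw [sum_congr rfl fun u _ => hsplit u, sum_add_distrib, mul_sum, sum_range_succ',
    sum_range_succ' (fun u => ((m : ℝ) + 1 + h + u) * _ * _),
    sum_range_succ (fun u => ((l : ℝ) - u) * _ * _), sub_self, zero_mul, zero_mul, add_zero,
    ← mul_assoc, sqrt_mul_AcoefExt_succ_zero, Nat.cast_zero, add_zero, add_right_comm (∑ _ ∈ _, _),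
    ← sum_add_distrib]
  congr 1
  refine sum_congr rfl fun v _ => ?_
  rw [← mul_assoc, sqrt_mul_AcoefExt_succ_succ, add_mul, Nat.cast_succ]

/-- the kernel `K_{m,h,l}` obeys the Jacobi-type differential equation
`−(1−α) K' = ((1+Ω²)/(4Ω))(2m+h+1) K − ((1−Ω²)/(4Ω))[√(m(m+h)) K_{m−1} +
√((m+1)(m+h+1)) K_{m+1}]`. -/
theorem stmt17 (Ω : ℝ) (hΩ0 : 0 < Ω) (hΩ1 : Ω < 1)
    (α : ℝ) (hα0 : 0 < α) (hα1 : α < 1) (m l h : ℕ) :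
    -(1 - α) * deriv (Kfun Ω m h l) α =
      (1 + Ω ^ 2) / (4 * Ω) * (2 * (m : ℝ) + (h : ℝ) + 1) * Kfun Ω m h l α
        - (1 - Ω ^ 2) / (4 * Ω) *
            (Real.sqrt ((m * (m + h) : ℕ)) * Kfun Ω (m - 1) h l α
              + Real.sqrt (((m + 1) * (m + h + 1) : ℕ)) * Kfun Ω (m + 1) h l α) := by
  have hs : 0 < 1 - α := by linarith
  have hC : 0 < (1 - Ω) ^ 2 / (4 * Ω) := by
    have : 0 < 1 - Ω := by linarith
    positivity
  have hβ : 0 < (1 - Ω ^ 2) / (4 * Ω) := by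
    have : 0 < 1 - Ω ^ 2 := by nlinarith
    positivity
  have hq : 0 < 1 + (1 - Ω) ^ 2 / (4 * Ω) * α := by positivity
  have hev : Kfun Ω m h l =ᶠ[nhds α] fun x => ∑ u ∈ range (l + 1), AcoefExt m l h u *
      kernelTerm ((1 - Ω) ^ 2 / (4 * Ω)) ((1 - Ω ^ 2) / (4 * Ω)) m l h u x := by
    filter_upwards [Ioo_mem_nhds hα0 hα1] with x hx
    exact Kfun_eq_sum_kernelTerm hΩ0 hΩ1 hx.1 hx.2 m h l
  have hder := (HasDerivAt.fun_sum fun u (_ : u ∈ range (l + 1)) =>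
    (hasDerivAt_kernelTerm hβ.ne' hα0 hα1 hq.ne' m l h u).const_mul (AcoefExt m l h u)).deriv
  rw [hev.deriv_eq, hder]
  simp only [Kfun_eq_sum_kernelTerm hΩ0 hΩ1 hα0 hα1]
  rw [sqrt_mul_sum_pred hβ.ne' hα0.ne' hq.ne', sqrt_mul_sum_succ, ← sum_add_distrib,
    mul_sum, mul_sum, mul_sum, ← sum_sub_distrib]
  refine sum_congr rfl fun u _ => ?_
  have hβC : ((1 - Ω ^ 2) / (4 * Ω)) ^ 2 =
      (1 - Ω) ^ 2 / (4 * Ω) * ((1 - Ω) ^ 2 / (4 * Ω) + 1) := by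
    field_simp
    ring
  have hD : (1 + Ω ^ 2) / (4 * Ω) = (1 - Ω) ^ 2 / (4 * Ω) + 1 / 2 := by
    field_simp
    ring
  rw [hD]
  generalize kernelTerm _ _ m l h u α = T
  generalize (1 - Ω ^ 2) / (4 * Ω) = β at *
  generalize (1 - Ω) ^ 2 / (4 * Ω) = C at *
  have hβ' := hβ.ne'
  have hs' := hs.ne'
  have hq' := hq.ne'
  have key : -(1 - α) * (((m : ℝ) + l - 2 * u) / α - ((h : ℝ) + 1 + 2 * u) / 2 / (1 - α)
        - ((m : ℝ) + l + h + 1) * C / (1 + C * α)) =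
      (C + 1 / 2) * (2 * m + h + 1) - (((m : ℝ) - u) * ((1 + C * α) / α) +
        (((m : ℝ) + 1 + h + u) * (C * (C + 1) * α) + ((l : ℝ) - u) * ((1 - α) / α)) /
          (1 + C * α)) := by
    field_simp
    ring
  rw [← hβC] at key
  have e1 : β * ((1 + C * α) / (β * α)) = (1 + C * α) / α := by field_simp
  have e2 : β * ((((m : ℝ) + 1 + h + u) + ((l : ℝ) - u) * ((1 - α) / (β * α) ^ 2)) *
      (β * α / (1 + C * α))) = (((m : ℝ) + 1 + h + u) * (β ^ 2 * α) +
        ((l : ℝ) - u) * ((1 - α) / α)) / (1 + C * α) := by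
    field_simp
  linear_combination AcoefExt m l h u * T * (key + ((m : ℝ) - u) * e1 + e2)
end
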